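/- arXiv:0911.3633 — 2 statements merged into one kernel-verified Lean document; each statement's English description precedes it below -/
import Mathlib

section
/- Every 2-maximum class C ⊆ {0,1}^n (n ≥ 2) can be corner-peeled. -/
open Finset

namespace GeomCompress

/-- `C` shatters the coordinate set `Y`: every pattern on `Y` is realized by some concept. -/
def Shatters {n : ℕ} (C : Finset (Fin n → Bool)) (Y : Finset (Fin n)) : Prop :=
  ∀ p : Fin n → Bool, ∃ c ∈ C, ∀ i ∈ Y, c i = p i

/-- The VC dimension of `C` equals `d`. -/
def VCDimEq {n : ℕ} (C : Finset (Fin n → Bool)) (d : ℕ) : Prop :=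
  (∃ Y : Finset (Fin n), Y.card = d ∧ Shatters C Y) ∧
    ∀ Y : Finset (Fin n), Shatters C Y → Y.card ≤ d

/-- `C` is a `d`-maximum class: VC dimension `d` and maximum possible cardinality. -/
def IsMaximum {n : ℕ} (C : Finset (Fin n → Bool)) (d : ℕ) : Prop :=
  VCDimEq C d ∧ C.card = ∑ i ∈ Finset.range (d + 1), Nat.choose n i

/-- Hamming distance between two Boolean vectors. -/
def hamming {n : ℕ} (u v : Fin n → Bool) : ℕ :=
  (Finset.univ.filter fun i => u i ≠ v i).card

/-- Adjacency in the one-inclusion graph: differ in exactly one coordinate. -/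
def Adj {n : ℕ} (u v : Fin n → Bool) : Prop := hamming u v = 1

instance {n : ℕ} (u v : Fin n → Bool) : Decidable (Adj u v) := by
  unfold Adj; infer_instance

/-- `Q` is a cube of `C` colored by `I`: a subset of `C` whose elements agree outside `I`
and realize all patterns on `I`. -/
def IsCube {n : ℕ} (C Q : Finset (Fin n → Bool)) (I : Finset (Fin n)) : Prop :=
  Q ⊆ C ∧ (∀ u ∈ Q, ∀ v ∈ Q, ∀ i, i ∉ I → u i = v i) ∧
    ∀ p : Fin n → Bool, ∃ u ∈ Q, ∀ i ∈ I, u i = p i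

/-- `v` is a corner vertex of `C`: there is a unique cube of maximum dimension among all
cubes of `C` containing `v`, and all neighbors of `v` in the one-inclusion graph of `C`
lie in that cube. -/
def IsCorner {n : ℕ} (C : Finset (Fin n → Bool)) (v : Fin n → Bool) : Prop :=
  ∃ Q I, IsCube C Q I ∧ v ∈ Q ∧
    (∀ Q' I', IsCube C Q' I' → v ∈ Q' → I'.card ≤ I.card) ∧
    (∀ Q' I', IsCube C Q' I' → v ∈ Q' → I'.card = I.card → Q' = Q) ∧
    ∀ u ∈ C, Adj u v → u ∈ Q

/-- The class remaining after peeling the first `t` vertices of the ordering `v`. -/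
def Peeled {n m : ℕ} (C : Finset (Fin n → Bool)) (v : Fin m → (Fin n → Bool)) (t : Fin m) :
    Finset (Fin n → Bool) :=
  C \ (Finset.univ.filter fun s : Fin m => s < t).image v

/-- `v` is a corner-peeling ordering of `C`: an enumeration of `C` such that each `v t`
is a corner vertex of the class remaining before step `t`. -/
def IsCornerPeeling {n : ℕ} (C : Finset (Fin n → Bool)) (v : Fin C.card → (Fin n → Bool)) :
    Prop :=
  Function.Injective v ∧ (∀ t, v t ∈ C) ∧ ∀ t, IsCorner (Peeled C v t) (v t)

/-- Degree of `v` in the one-inclusion graph of `C`. -/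
def degreeIn {n : ℕ} (C : Finset (Fin n → Bool)) (v : Fin n → Bool) : ℕ :=
  (C.filter fun u => Adj u v).card

/-- The colors of the edges incident to `v` in the one-inclusion graph of `C`. -/
def incidentColors {n : ℕ} (C : Finset (Fin n → Bool)) (v : Fin n → Bool) : Finset (Fin n) :=
  Finset.univ.filter fun i => ∃ u ∈ C, Adj u v ∧ u i ≠ v i

/-- `C` is shortest-path closed: any two concepts are joined in the one-inclusion graph of
`C` by a path whose length is their Hamming distance. -/
def SPClosed {n : ℕ} (C : Finset (Fin n → Bool)) : Prop :=
  ∀ u ∈ C, ∀ v ∈ C, ∃ p : ℕ → (Fin n → Bool),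
    p 0 = u ∧ p (hamming u v) = v ∧ (∀ k ≤ hamming u v, p k ∈ C) ∧
    ∀ k < hamming u v, Adj (p k) (p (k + 1))

/-- `Q` (colored by `I`, with `I.card = d - 1`) is a cube of the boundary `∂C` of the
`d`-maximum class `C`: it is a face of exactly one `d`-cube of `C`. -/
def IsBoundaryCube {n : ℕ} (C : Finset (Fin n → Bool)) (d : ℕ)
    (Q : Finset (Fin n → Bool)) (I : Finset (Fin n)) : Prop :=
  IsCube C Q I ∧ I.card = d - 1 ∧
    (∃ Q' I', IsCube C Q' I' ∧ I'.card = d ∧ Q ⊆ Q' ∧ I ⊆ I') ∧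
    ∀ Q₁ I₁ Q₂ I₂, IsCube C Q₁ I₁ → I₁.card = d → Q ⊆ Q₁ → I ⊆ I₁ →
      IsCube C Q₂ I₂ → I₂.card = d → Q ⊆ Q₂ → I ⊆ I₂ → Q₁ = Q₂

/-- Standard inner product on `Fin d → ℝ`. -/
def dotR {d : ℕ} (x y : Fin d → ℝ) : ℝ := ∑ i, x i * y i

/-- `x` lies on none of the hyperplanes `⟪a i, ·⟫ = b i`. -/
def OnNoHyperplane {d N : ℕ} (a : Fin N → Fin d → ℝ) (b : Fin N → ℝ) (x : Fin d → ℝ) :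
    Prop :=
  ∀ i, dotR (a i) x ≠ b i

/-- The sign vector of the point `x` with respect to the oriented hyperplanes `(a, b)`. -/
noncomputable def signVec {d N : ℕ} (a : Fin N → Fin d → ℝ) (b : Fin N → ℝ)
    (x : Fin d → ℝ) : Fin N → Bool :=
  fun i => decide (b i < dotR (a i) x)

/-- `C` is the concept class induced by the arrangement `(a, b)`: the set of sign vectors
of points lying on none of the hyperplanes. -/
def IsInducedClass {d N : ℕ} (a : Fin N → Fin d → ℝ) (b : Fin N → ℝ)
    (C : Finset (Fin N → Bool)) : Prop :=
  ∀ c, c ∈ C ↔ ∃ x : Fin d → ℝ, OnNoHyperplane a b x ∧ signVec a b x = c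

/-- A simple linear arrangement in `ℝ^d`: every `≤ d` of the hyperplanes are in general
position (normals linearly independent, so every `k ≤ d` of them intersect in an affine
subspace of dimension `d - k`), and every `d+1` of them have empty common intersection. -/
def SimpleArrangement (d : ℕ) {N : ℕ} (a : Fin N → Fin d → ℝ) (b : Fin N → ℝ) : Prop :=
  (∀ S : Finset (Fin N), S.card ≤ d → LinearIndependent ℝ (fun i : S => a i.1)) ∧
    ∀ S : Finset (Fin N), S.card = d + 1 → ¬∃ x : Fin d → ℝ, ∀ i ∈ S, dotR (a i) x = b i

/-- Membership in the open unit ball (Klein model of hyperbolic space `H^k`). -/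
def inBall {k : ℕ} (x : Fin k → ℝ) : Prop := ∑ i, x i ^ 2 < 1

/-- A simple hyperbolic `d`-arrangement in the Klein model `H^k`: every `d` of the
hyperplanes intersect inside the unit ball in a `(k-d)`-dimensional hyperbolic plane
(normals independent and common point inside the ball), and every `d+1` of them have
empty common intersection inside the ball. -/
def SimpleHyperbolicArrangement (d : ℕ) {k N : ℕ} (a : Fin N → Fin k → ℝ)
    (b : Fin N → ℝ) : Prop :=
  (∀ S : Finset (Fin N), S.card = d →
      LinearIndependent ℝ (fun i : S => a i.1) ∧
        ∃ x : Fin k → ℝ, inBall x ∧ ∀ i ∈ S, dotR (a i) x = b i) ∧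
    ∀ S : Finset (Fin N), S.card = d + 1 →
      ¬∃ x : Fin k → ℝ, inBall x ∧ ∀ i ∈ S, dotR (a i) x = b i

/-- The concept class induced by a hyperbolic arrangement: sign vectors of points of the
open unit ball lying on none of the hyperplanes. -/
def IsInducedClassH {k N : ℕ} (a : Fin N → Fin k → ℝ) (b : Fin N → ℝ)
    (C : Finset (Fin N → Bool)) : Prop :=
  ∀ c, c ∈ C ↔ ∃ x : Fin k → ℝ, inBall x ∧ OnNoHyperplane a b x ∧ signVec a b x = c

/-- A generic arrangement of oriented affine hyperplanes in `ℝ^n`: every subcollection of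
`k` hyperplanes, `2 ≤ k ≤ n`, either has empty common intersection or intersects
transversely (normals linearly independent, giving an affine subspace of dim `n - k`). -/
def GenericArrangement {n N : ℕ} (a : Fin N → Fin n → ℝ) (b : Fin N → ℝ) : Prop :=
  ∀ S : Finset (Fin N), 2 ≤ S.card → S.card ≤ n →
    (¬∃ x : Fin n → ℝ, ∀ i ∈ S, dotR (a i) x = b i) ∨
      LinearIndependent ℝ (fun i : S => a i.1)

/-- `C` is a maximal class of VC dimension `d`: adding any new concept increases the VC
dimension. -/
def IsMaximalClass {n : ℕ} (C : Finset (Fin n → Bool)) (d : ℕ) : Prop :=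
  VCDimEq C d ∧
    ∀ c : Fin n → Bool, c ∉ C →
      ∃ Y : Finset (Fin n), d < Y.card ∧ Shatters (insert c C) Y

/-- A path in the one-inclusion graph of `C` avoiding `C'`, from a vertex of `Q1` to a
vertex of `Q2`. -/
def CConnPath {n : ℕ} (C C' Q1 Q2 : Finset (Fin n → Bool)) : Prop :=
  ∃ (L : ℕ) (p : ℕ → Fin n → Bool),
    p 0 ∈ Q1 ∧ p L ∈ Q2 ∧ (∀ j ≤ L, p j ∈ C ∧ p j ∉ C') ∧
      ∀ j < L, Adj (p j) (p (j + 1))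

/-- `Q1` and `Q2` are `d`-cubes of `C` joined by a path of the one-inclusion graph of `C`
avoiding `C'`. -/
def CComponentRel {n : ℕ} (C C' : Finset (Fin n → Bool)) (d : ℕ)
    (Q1 Q2 : Finset (Fin n → Bool)) : Prop :=
  (∃ I, IsCube C Q1 I ∧ I.card = d) ∧ (∃ I, IsCube C Q2 I ∧ I.card = d) ∧
    CConnPath C C' Q1 Q2

/-- `Comp` enumerates the `C'`-connected components of `C`: each component is a union of
`d`-cubes of `C`, every `d`-cube lies in exactly one component, and two `d`-cubes lie in
the same component iff they are related under the transitive closure of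
`C'`-connectedness. -/
def IsComponents {n : ℕ} (C C' : Finset (Fin n → Bool)) (d : ℕ) {k : ℕ}
    (Comp : Fin k → Finset (Fin n → Bool)) : Prop :=
  (∀ q, ∀ x ∈ Comp q, ∃ Q I, IsCube C Q I ∧ I.card = d ∧ x ∈ Q ∧ Q ⊆ Comp q) ∧
  (∀ Q I, IsCube C Q I → I.card = d → ∃ q, Q ⊆ Comp q) ∧
  (∀ q q' Q I, IsCube C Q I → I.card = d → Q ⊆ Comp q → Q ⊆ Comp q' → q = q') ∧
  ∀ q Q1 I1, IsCube C Q1 I1 → I1.card = d → Q1 ⊆ Comp q →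
    ∀ Q2 I2, IsCube C Q2 I2 → I2.card = d →
      (Q2 ⊆ Comp q ↔ Relation.TransGen (CComponentRel C C' d) Q1 Q2)

/-- Append the bit `b` as a new last coordinate. -/
def app {n : ℕ} (c : Fin n → Bool) (b : Bool) : Fin (n + 1) → Bool := Fin.snoc c b

/-- The lift `(C' × {0,1}) ∪ ⋃_q (Comp q × {p q})`. -/
def LiftClass {n k : ℕ} (C' : Finset (Fin n → Bool))
    (Comp : Fin k → Finset (Fin n → Bool)) (p : Fin k → Bool) :
    Finset (Fin (n + 1) → Bool) :=
  C'.image (fun c => app c false) ∪ C'.image (fun c => app c true) ∪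
    Finset.univ.biUnion fun q => (Comp q).image fun c => app c (p q)

variable {n : ℕ}

/-- The vector `x` with its `i`-th bit negated. -/
def flip (x : Fin n → Bool) (i : Fin n) : Fin n → Bool := Function.update x i (!x i)

@[simp] lemma flip_self (x : Fin n → Bool) (i : Fin n) : flip x i i = !x i := by simp [flip]

lemma flip_of_ne (x : Fin n → Bool) {i k : Fin n} (h : k ≠ i) : flip x i k = x k := by
  simp [flip, h]

lemma flip_apply (x : Fin n → Bool) (i k : Fin n) :
    flip x i k = if k = i then !x k else x k := by
  by_cases h : k = i
  · subst h; simp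
  · simp [flip_of_ne x h, h]

@[simp] lemma flip_flip (x : Fin n → Bool) (i : Fin n) : flip (flip x i) i = x := by
  ext k; by_cases h : k = i <;> simp [flip_apply, h]

lemma flip_comm (x : Fin n → Bool) (i j : Fin n) : flip (flip x i) j = flip (flip x j) i := by
  ext k; simp only [flip_apply]; split_ifs <;> rfl

lemma flip_ne (x : Fin n → Bool) (i : Fin n) : flip x i ≠ x := fun h => by
  have := congrFun h i
  simp at this

lemma hamming_flip_lt {x y : Fin n → Bool} {i : Fin n} (h : x i ≠ y i) :
    hamming (flip x i) y < hamming x y := by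
  refine Finset.card_lt_card (Finset.ssubset_iff_of_subset ?_ |>.2 ⟨i, ?_, ?_⟩)
  · intro k
    by_cases hk : k = i
    · subst hk; simp [h]
    · simp [flip_of_ne x hk]
  · simp [h]
  · simpa using h

lemma lt_hamming_flip {x y : Fin n → Bool} {i : Fin n} (h : x i = y i) :
    hamming x y < hamming (flip x i) y := by
  have := hamming_flip_lt (x := flip x i) (y := y) (i := i) (by simp [h])
  simpa using this

lemma exists_eq_flip_of_adj {u v : Fin n → Bool} (h : Adj u v) : ∃ i, u = flip v i := by
  obtain ⟨i, hi⟩ := Finset.card_eq_one.1 h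
  refine ⟨i, funext fun k => ?_⟩
  have hk : u k ≠ v k ↔ k = i := by simpa using Finset.ext_iff.1 hi k
  by_cases hki : k = i
  · subst hki
    have := hk.2 rfl
    rw [flip_self]
    cases h1 : u k <;> cases h2 : v k <;> simp_all
  · rw [flip_of_ne v hki]
    by_contra hc
    exact hki (hk.1 hc)

/-! ### Shattered families and extremal classes -/

open Classical in
/-- The family of all coordinate sets shattered by `C`. -/
noncomputable def shattered (C : Finset (Fin n → Bool)) : Finset (Finset (Fin n)) :=
  Finset.univ.filter (Shatters C)

lemma mem_shattered {C : Finset (Fin n → Bool)} {S : Finset (Fin n)} :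
    S ∈ shattered C ↔ Shatters C S := by simp [shattered]

lemma Shatters.mono {C D : Finset (Fin n → Bool)} (h : C ⊆ D) {S : Finset (Fin n)}
    (hS : Shatters C S) : Shatters D S := fun p =>
  let ⟨c, hc, hcp⟩ := hS p
  ⟨c, h hc, hcp⟩

lemma Shatters.notMem {C : Finset (Fin n → Bool)} {S : Finset (Fin n)} {i : Fin n} {b : Bool}
    (hb : ∀ x ∈ C, x i = b) (hS : Shatters C S) : i ∉ S := fun hi => by
  obtain ⟨c, hc, hcp⟩ := hS fun _ => !b
  have := hcp i hi
  rw [hb c hc] at this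
  simp at this

lemma shatters_insert {C D E : Finset (Fin n → Bool)} {S : Finset (Fin n)} {i : Fin n}
    (hi : i ∉ S) (hD : Shatters D S) (hE : Shatters E S)
    (hDC : ∀ x ∈ D, ∃ y ∈ C, y i = false ∧ ∀ k ≠ i, y k = x k)
    (hEC : ∀ x ∈ E, ∃ y ∈ C, y i = true ∧ ∀ k ≠ i, y k = x k) :
    Shatters C (insert i S) := by
  intro p
  cases hp : p i
  · obtain ⟨c, hc, hcp⟩ := hD p
    obtain ⟨y, hy, hyi, hyk⟩ := hDC c hc
    refine ⟨y, hy, fun k hk => ?_⟩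
    rcases Finset.mem_insert.1 hk with rfl | hk
    · rw [hyi, hp]
    · rw [hyk k (fun h => hi (h ▸ hk)), hcp k hk]
  · obtain ⟨c, hc, hcp⟩ := hE p
    obtain ⟨y, hy, hyi, hyk⟩ := hEC c hc
    refine ⟨y, hy, fun k hk => ?_⟩
    rcases Finset.mem_insert.1 hk with rfl | hk
    · rw [hyi, hp]
    · rw [hyk k (fun h => hi (h ▸ hk)), hcp k hk]

lemma card_add_card_le_shattered {C : Finset (Fin n → Bool)} {i : Fin n}
    {A B : Finset (Finset (Fin n))} (hA : ∀ S ∈ A, i ∉ S ∧ Shatters C S)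
    (hB : ∀ S ∈ B, i ∉ S ∧ Shatters C (insert i S)) :
    A.card + B.card ≤ (shattered C).card := by
  classical
  have hinj : Set.InjOn (insert i : Finset (Fin n) → Finset (Fin n)) B := by
    intro S hS T hT h
    have := congrArg (fun U => Finset.erase U i) h
    simpa [Finset.erase_insert (hB S hS).1, Finset.erase_insert (hB T hT).1] using this
  rw [← Finset.card_image_of_injOn hinj, ← Finset.card_union_of_disjoint]
  · refine Finset.card_le_card fun S hS => mem_shattered.2 ?_
    rcases Finset.mem_union.1 hS with hS | hS
    · exact (hA S hS).2
    · obtain ⟨T, hT, rfl⟩ := Finset.mem_image.1 hS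
      exact (hB T hT).2
  · rw [Finset.disjoint_left]
    intro S hS hS'
    obtain ⟨T, hT, rfl⟩ := Finset.mem_image.1 hS'
    exact (hA _ hS).1 (Finset.mem_insert_self i T)

/-- The concepts of `C` with `i`-th bit equal to `b`. -/
def half (C : Finset (Fin n → Bool)) (i : Fin n) (b : Bool) : Finset (Fin n → Bool) :=
  C.filter fun x => x i = b

lemma mem_half {C : Finset (Fin n → Bool)} {i : Fin n} {b : Bool} {x : Fin n → Bool} :
    x ∈ half C i b ↔ x ∈ C ∧ x i = b := Finset.mem_filter

lemma card_half_add_card_half (C : Finset (Fin n → Bool)) (i : Fin n) (b : Bool) :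
    (half C i b).card + (half C i (!b)).card = C.card := by
  rw [← Finset.card_filter_add_card_filter_not (s := C) (fun x => x i = b)]
  congr 2
  refine Finset.filter_congr fun x _ => ?_
  cases x i <;> cases b <;> simp

lemma card_shattered_half_add_le (C : Finset (Fin n → Bool)) (i : Fin n) (b : Bool) :
    (shattered (half C i b)).card + (shattered (half C i (!b))).card ≤ (shattered C).card := by
  classical
  rw [← Finset.card_union_add_card_inter]
  have hsub (b : Bool) : half C i b ⊆ C := Finset.filter_subset _ _
  have hnot (b : Bool) {S} (hS : S ∈ shattered (half C i b)) : i ∉ S :=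
    (mem_shattered.1 hS).notMem (b := b) fun x hx => (mem_half.1 hx).2
  refine card_add_card_le_shattered (i := i) (fun S hS => ?_) fun S hS => ?_
  · rcases Finset.mem_union.1 hS with hS | hS <;>
      exact ⟨hnot _ hS, (mem_shattered.1 hS).mono (hsub _)⟩
  · obtain ⟨h1, h2⟩ := Finset.mem_inter.1 hS
    have key : Shatters (half C i false) S ∧ Shatters (half C i true) S := by
      rw [mem_shattered] at h1 h2
      cases b
      · exact ⟨h1, h2⟩
      · exact ⟨h2, h1⟩
    refine ⟨hnot _ h1, shatters_insert (hnot _ h1) key.1 key.2 ?_ ?_⟩ <;>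
    · intro x hx
      obtain ⟨hx, hxi⟩ := mem_half.1 hx
      exact ⟨x, hx, hxi, fun _ _ => rfl⟩

/-- Pajor's inequality: a class shatters at least as many sets as it has elements. -/
lemma card_le_card_shattered (C : Finset (Fin n → Bool)) : C.card ≤ (shattered C).card := by
  induction hm : C.card using Nat.strong_induction_on generalizing C with
  | _ m ih =>
    subst hm
    rcases Nat.lt_or_ge 1 C.card with h | h
    · obtain ⟨x, hx, y, hy, hxy⟩ := Finset.one_lt_card.1 h
      obtain ⟨i, hi⟩ := Function.ne_iff.1 hxy
      have hadd := card_half_add_card_half C i (x i)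
      have hyi : y i = !x i := by cases h1 : x i <;> cases h2 : y i <;> simp_all
      have hx0 : 0 < (half C i (x i)).card := Finset.card_pos.2 ⟨x, mem_half.2 ⟨hx, rfl⟩⟩
      have hy0 : 0 < (half C i (!x i)).card := Finset.card_pos.2 ⟨y, mem_half.2 ⟨hy, hyi⟩⟩
      have h1 := ih _ (by omega) (half C i (x i)) rfl
      have h2 := ih _ (by omega) (half C i (!x i)) rfl
      have := card_shattered_half_add_le C i (x i)
      omega
    · rcases Nat.eq_zero_or_pos C.card with h0 | h0
      · omega
      · obtain ⟨x, hx⟩ := Finset.card_pos.1 h0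
        have : 0 < (shattered C).card :=
          Finset.card_pos.2 ⟨∅, mem_shattered.2 fun p => ⟨x, hx, by simp⟩⟩
        omega

/-- `C` shatters no more sets than it has elements. -/
def IsExtremal (C : Finset (Fin n → Bool)) : Prop := (shattered C).card ≤ C.card

lemma IsExtremal.isExtremal_half {C : Finset (Fin n → Bool)} (hC : IsExtremal C) (i : Fin n) (b : Bool) :
    IsExtremal (half C i b) := by
  have h1 := card_half_add_card_half C i b
  have h2 := card_shattered_half_add_le C i b
  have h3 := card_le_card_shattered (half C i !b)
  unfold IsExtremal at *
  omega

/-- The concepts of `C` agreeing with `x` on `F`. -/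
def subcube (C : Finset (Fin n → Bool)) (F : Finset (Fin n)) (x : Fin n → Bool) :
    Finset (Fin n → Bool) :=
  C.filter fun z => ∀ k ∈ F, z k = x k

lemma mem_subcube {C : Finset (Fin n → Bool)} {F : Finset (Fin n)} {x z : Fin n → Bool} :
    z ∈ subcube C F x ↔ z ∈ C ∧ ∀ k ∈ F, z k = x k := Finset.mem_filter

lemma IsExtremal.isExtremal_subcube {C : Finset (Fin n → Bool)} (hC : IsExtremal C) (F : Finset (Fin n))
    (x : Fin n → Bool) : IsExtremal (subcube C F x) := by
  induction F using Finset.induction_on with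
  | empty => simpa [subcube] using hC
  | insert i F _ ih =>
    have : subcube C (insert i F) x =
        half (subcube C F x) i (x i) := by
      ext z
      simp only [mem_subcube, mem_half, Finset.forall_mem_insert]
      tauto
    rw [this]
    exact ih.isExtremal_half i _

/-- Any concept of `C` has a neighbour in `C` one step closer to any other given concept. -/
def IsIsometric (C : Finset (Fin n → Bool)) : Prop :=
  ∀ x ∈ C, ∀ y ∈ C, x ≠ y → ∃ i, x i ≠ y i ∧ flip x i ∈ C

lemma IsExtremal.isIsometric {C : Finset (Fin n → Bool)} (hC : IsExtremal C) :
    IsIsometric C := by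
  classical
  intro x hx y hy hxy
  induction hm : hamming x y using Nat.strong_induction_on generalizing y with
  | _ m ih =>
    subst hm
    by_contra! hno
    set D : Finset (Fin n) := Finset.univ.filter fun i => x i ≠ y i with hD
    have hsub : subcube C Dᶜ x = {x, y} := by
      ext z
      simp only [mem_subcube, Finset.mem_insert, Finset.mem_singleton, Finset.mem_compl, hD,
        Finset.mem_filter, Finset.mem_univ, true_and, not_not]
      constructor
      · rintro ⟨hz, hzx⟩
        by_contra! hne
        obtain ⟨k, hk⟩ := Function.ne_iff.1 hne.2
        have hxyk : x k ≠ y k := fun h => hk ((hzx k h).trans h)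
        have hlt : hamming x z < hamming x y := by
          refine Finset.card_lt_card (Finset.ssubset_iff_of_subset ?_ |>.2 ⟨k, ?_, ?_⟩)
          · intro l
            simp only [Finset.mem_filter, Finset.mem_univ, true_and]
            exact fun hl h => hl (hzx l h).symm
          · simpa using hxyk
          · simp only [Finset.mem_filter, Finset.mem_univ, true_and, not_not]
            cases h1 : x k <;> cases h2 : y k <;> cases h3 : z k <;> simp_all
        obtain ⟨i, hi, hic⟩ := ih _ hlt z hz hne.1.symm rfl
        exact hno i (fun h => hi (hzx i h).symm) hic
      · rintro (rfl | rfl)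
        · exact ⟨hx, fun _ _ => rfl⟩
        · exact ⟨hy, fun _ h => h.symm⟩
    have hext := hC.isExtremal_subcube Dᶜ x
    rw [hsub] at hext
    have h2 : ({x, y} : Finset (Fin n → Bool)).card = 2 := Finset.card_pair hxy
    obtain ⟨i, hi⟩ := Function.ne_iff.1 hxy
    have hsing (k : Fin n) (hk : x k ≠ y k) : Shatters {x, y} {k} := by
      intro p
      by_cases h : x k = p k
      · exact ⟨x, by simp, by simpa using h⟩
      · refine ⟨y, by simp, ?_⟩
        simp only [Finset.mem_singleton, forall_eq]
        cases h1 : x k <;> cases h2 : y k <;> cases h3 : p k <;> simp_all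
    obtain ⟨j, hj, hji⟩ : ∃ j, x j ≠ y j ∧ j ≠ i := by
      by_contra! hall
      refine hno i hi ?_
      convert hy
      ext k
      by_cases hk : k = i
      · subst hk
        rw [flip_self]
        cases h1 : x k <;> cases h2 : y k <;> simp_all
      · rw [flip_of_ne x hk]
        by_contra hc
        exact hk (hall k hc)
    have h3 : ({∅, {i}, {j}} : Finset (Finset (Fin n))) ⊆ shattered {x, y} := by
      intro S hS
      simp only [Finset.mem_insert, Finset.mem_singleton] at hS
      rw [mem_shattered]
      rcases hS with rfl | rfl | rfl
      · exact fun p => ⟨x, by simp, by simp⟩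
      · exact hsing i hi
      · exact hsing j hj
    have h4 := Finset.card_le_card h3
    have h5 : ({∅, {i}, {j}} : Finset (Finset (Fin n))).card = 3 := by
      rw [Finset.card_eq_three]
      refine ⟨_, _, _, ?_, ?_, ?_, rfl⟩
      · exact (Finset.singleton_ne_empty i).symm
      · exact (Finset.singleton_ne_empty j).symm
      · simpa using hji.symm
    unfold IsExtremal at hext
    omega

/-- The bottom ends of the edges of colour `k` in `C`. -/
def reduction (C : Finset (Fin n → Bool)) (k : Fin n) : Finset (Fin n → Bool) :=
  C.filter fun x => x k = false ∧ flip x k ∈ C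

lemma mem_reduction {C : Finset (Fin n → Bool)} {k : Fin n} {x : Fin n → Bool} :
    x ∈ reduction C k ↔ x ∈ C ∧ x k = false ∧ flip x k ∈ C := Finset.mem_filter

lemma IsExtremal.isExtremal_reduction {C : Finset (Fin n → Bool)} (hC : IsExtremal C) (k : Fin n) :
    IsExtremal (reduction C k) := by
  classical
  set T := (half C k true).image (flip · k) with hT
  set P := half C k false ∪ T with hP
  have hTmem {x : Fin n → Bool} : x ∈ T ↔ flip x k ∈ C ∧ x k = false := by
    simp only [hT, Finset.mem_image, mem_half]
    constructor
    · rintro ⟨y, ⟨hy, hyk⟩, rfl⟩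
      simp [hy, hyk]
    · rintro ⟨h1, h2⟩
      exact ⟨flip x k, ⟨h1, by simp [h2]⟩, flip_flip x k⟩
  have hinter : half C k false ∩ T = reduction C k := by
    ext x
    simp only [Finset.mem_inter, mem_half, hTmem, mem_reduction]
    tauto
  have hcard : P.card + (reduction C k).card = C.card := by
    rw [hP, ← hinter, Finset.card_union_add_card_inter, hT, Finset.card_image_of_injective]
    · exact card_half_add_card_half C k false
    · intro x y h
      simpa using congrArg (flip · k) h
  have hPk : ∀ x ∈ P, x k = false := by
    intro x hx
    rcases Finset.mem_union.1 hx with hx | hx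
    · exact (mem_half.1 hx).2
    · exact (hTmem.1 hx).2
  have hle : (shattered P).card + (shattered (reduction C k)).card ≤
      (shattered C).card := by
    refine card_add_card_le_shattered (i := k) (fun S hS => ?_) fun S hS => ?_
    · have hS := mem_shattered.1 hS
      have hk : k ∉ S := hS.notMem hPk
      refine ⟨hk, fun p => ?_⟩
      obtain ⟨c, hc, hcp⟩ := hS p
      rcases Finset.mem_union.1 hc with hc | hc
      · exact ⟨c, (mem_half.1 hc).1, hcp⟩
      · refine ⟨flip c k, (hTmem.1 hc).1, fun l hl => ?_⟩
        rw [flip_of_ne c (by rintro rfl; exact hk hl), hcp l hl]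
    · have hS := mem_shattered.1 hS
      have hk : k ∉ S := hS.notMem (b := false) fun x hx => (mem_reduction.1 hx).2.1
      refine ⟨hk, shatters_insert hk hS hS ?_ ?_⟩
      · intro x hx
        obtain ⟨h1, h2, -⟩ := mem_reduction.1 hx
        exact ⟨x, h1, h2, fun _ _ => rfl⟩
      · intro x hx
        obtain ⟨-, h2, h3⟩ := mem_reduction.1 hx
        exact ⟨flip x k, h3, by simp [h2], fun l hl => flip_of_ne x hl⟩
  have := card_le_card_shattered P
  unfold IsExtremal at *
  omega

/-! ### Corners -/

/-- The properties of two-dimensional ample classes that drive the peeling: no shattered set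
has three elements, and both the class and its classes of parallel edges are isometric. -/
structure IsTwoAmple (C : Finset (Fin n → Bool)) : Prop where
  card_le : ∀ S, Shatters C S → S.card ≤ 2
  isometric : IsIsometric C
  edges_isometric : ∀ k x y, x ∈ C → flip x k ∈ C → y ∈ C → flip y k ∈ C → x k = y k → x ≠ y →
    ∃ i, x i ≠ y i ∧ flip x i ∈ C ∧ flip (flip x i) k ∈ C

lemma IsExtremal.isTwoAmple {C : Finset (Fin n → Bool)} (hC : IsExtremal C)
    (h2 : ∀ S, Shatters C S → S.card ≤ 2) : IsTwoAmple C where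
  card_le := h2
  isometric := hC.isIsometric
  edges_isometric k x y hx hxk hy hyk hk hne := by
    cases h : x k
    · obtain ⟨i, hi, hm⟩ := (hC.isExtremal_reduction k).isIsometric x (mem_reduction.2 ⟨hx, h, hxk⟩) y
        (mem_reduction.2 ⟨hy, hk ▸ h, hyk⟩) hne
      exact ⟨i, hi, (mem_reduction.1 hm).1, (mem_reduction.1 hm).2.2⟩
    · obtain ⟨i, hi, hm⟩ := (hC.isExtremal_reduction k).isIsometric (flip x k)
        (mem_reduction.2 ⟨hxk, by simp [h], by simpa⟩) (flip y k)
        (mem_reduction.2 ⟨hyk, by simp [← hk, h], by simpa⟩)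
        (fun h => hne (by simpa using congrArg (flip · k) h))
      have hik : i ≠ k := by
        rintro rfl
        simp [hk] at hi
      obtain ⟨h1, -, h3⟩ := mem_reduction.1 hm
      rw [flip_of_ne x hik, flip_of_ne y hik] at hi
      rw [flip_comm x k i] at h1 h3
      rw [flip_flip] at h3
      exact ⟨i, hi, h3, h1⟩

/-- `v` has at most two neighbours in `C`, and if there are two, they span a square of `C`. -/
structure IsPeak (C : Finset (Fin n → Bool)) (v : Fin n → Bool) : Prop where
  mem : v ∈ C
  square : ∀ i j, i ≠ j → flip v i ∈ C → flip v j ∈ C → flip (flip v i) j ∈ C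
  card_le : (Finset.univ.filter fun i => flip v i ∈ C).card ≤ 2

lemma IsTwoAmple.erase {C : Finset (Fin n → Bool)} (hC : IsTwoAmple C) {v : Fin n → Bool}
    (hv : IsPeak C v) : IsTwoAmple (C.erase v) where
  card_le S hS := hC.card_le S (hS.mono (Finset.erase_subset _ _))
  isometric := by
    intro x hx y hy hxy
    obtain ⟨hxv, hx⟩ := Finset.mem_erase.1 hx
    obtain ⟨hyv, hy⟩ := Finset.mem_erase.1 hy
    obtain ⟨i, hi, hic⟩ := hC.isometric x hx y hy hxy
    by_cases h : flip x i = v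
    · have hx' : x = flip v i := by rw [← h, flip_flip]
      obtain ⟨j, hj, hjc⟩ := hC.isometric v hv.mem y hy (Ne.symm hyv)
      have hji : i ≠ j := by
        rintro rfl
        rw [hx'] at hi
        cases h1 : v i <;> cases h2 : y i <;> simp_all
      have hsq := hv.square i j hji (hx' ▸ hx) hjc
      refine ⟨j, ?_, Finset.mem_erase.2 ⟨?_, ?_⟩⟩
      · rwa [hx', flip_of_ne v hji.symm]
      · rw [hx']
        intro h
        have := congrFun h j
        simp [flip_of_ne v hji.symm] at this
      · rwa [hx']
    · exact ⟨i, hi, Finset.mem_erase.2 ⟨h, hic⟩⟩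
  edges_isometric := by
    have key : ∀ k x y, x ∈ C.erase v → flip x k ∈ C.erase v → y ∈ C.erase v →
        x k = y k → ∀ i, x i ≠ y i → flip y k ∈ C → flip (flip x i) k ∈ C → flip x i ≠ v := by
      intro k x y hx hxk hy hk i hi hykc hikc h
      obtain ⟨hxv, hx⟩ := Finset.mem_erase.1 hx
      obtain ⟨hyv, hy⟩ := Finset.mem_erase.1 hy
      have hik : i ≠ k := by rintro rfl; exact hi hk
      have hx' : x = flip v i := by rw [← h, flip_flip]
      rw [h] at hikc
      have hvk : v k = y k := by rw [← h, flip_of_ne x hik.symm, hk]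
      obtain ⟨j, hj, hjc, -⟩ :=
        hC.edges_isometric k v y hv.mem hikc hy hykc hvk (Ne.symm hyv)
      have hjk : j ≠ k := by rintro rfl; exact hj hvk
      have hji : j ≠ i := by
        rintro rfl
        rw [hx'] at hi
        cases h1 : v j <;> cases h2 : y j <;> simp_all
      have hsub : ({i, j, k} : Finset (Fin n)) ⊆
          Finset.univ.filter fun l => flip v l ∈ C := by
        intro l hl
        simp only [Finset.mem_insert, Finset.mem_singleton] at hl
        rw [Finset.mem_filter]
        rcases hl with rfl | rfl | rfl
        · exact ⟨Finset.mem_univ _, hx' ▸ hx⟩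
        · exact ⟨Finset.mem_univ _, hjc⟩
        · exact ⟨Finset.mem_univ _, hikc⟩
      have h3 : ({i, j, k} : Finset (Fin n)).card = 3 :=
        Finset.card_eq_three.2 ⟨i, j, k, hji.symm, hik, hjk, rfl⟩
      have := Finset.card_le_card hsub
      have := hv.card_le
      omega
    intro k x y hx hxk hy hyk hk hne
    have hxc := Finset.mem_of_mem_erase hx
    have hxkc := Finset.mem_of_mem_erase hxk
    have hyc := Finset.mem_of_mem_erase hy
    have hykc := Finset.mem_of_mem_erase hyk
    obtain ⟨i, hi, hic, hikc⟩ := hC.edges_isometric k x y hxc hxkc hyc hykc hk hne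
    have hik : i ≠ k := by rintro rfl; exact hi hk
    refine ⟨i, hi, Finset.mem_erase.2 ⟨key k x y hx hxk hy hk i hi hykc hikc, hic⟩,
      Finset.mem_erase.2 ⟨?_, hikc⟩⟩
    rw [flip_comm]
    refine key k (flip x k) (flip y k) hxk (by simpa using hx) hyk (by simp [hk]) i ?_ ?_ ?_
    · rwa [flip_of_ne x hik, flip_of_ne y hik]
    · simpa using hyc
    · rwa [flip_comm x k i, flip_flip]

/-- A geodesic of `C` from `y` to `x` leaves any set containing `y` but not `x`. -/
lemma IsIsometric.exists_exit {C : Finset (Fin n → Bool)} (hC : IsIsometric C)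
    (P : (Fin n → Bool) → Prop) {x y : Fin n → Bool} (hx : x ∈ C) (hy : y ∈ C) (hPy : P y)
    (hPx : ¬ P x) :
    ∃ z ∈ C, P z ∧ (∀ k, y k = x k → z k = x k) ∧ ∃ i, flip z i ∈ C ∧ ¬ P (flip z i) := by
  induction hm : hamming y x using Nat.strong_induction_on generalizing y with
  | _ m ih =>
    subst hm
    obtain ⟨i, hi, hic⟩ := hC y hy x hx (by rintro rfl; exact hPx hPy)
    by_cases h : P (flip y i)
    · obtain ⟨z, hz, hPz, hzk, hex⟩ := ih _ (hamming_flip_lt hi) hic h rfl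
      refine ⟨z, hz, hPz, fun k hk => hzk k ?_, hex⟩
      rw [flip_of_ne y (by rintro rfl; exact hi hk), hk]
    · exact ⟨y, hy, hPy, fun _ h => h, i, hic, h⟩

/-- Among the edges of colour `j` of `C` agreeing with `w` on `F`, if there is one besides that
of `w`, then there is a leaf `u`, attached by a square of colours `j` and `k`. -/
lemma IsTwoAmple.exists_leaf {C : Finset (Fin n → Bool)} (hC : IsTwoAmple C)
    {F : Finset (Fin n)} {j : Fin n} (hj : j ∈ F) {w : Fin n → Bool} (hw : w ∈ C)
    (hwj : flip w j ∈ C)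
    (hex : ∃ x ∈ C, flip x j ∈ C ∧ (∀ f ∈ F, x f = w f) ∧ x ≠ w) :
    ∃ u ∈ C, flip u j ∈ C ∧ (∀ f ∈ F, u f = w f) ∧ ∃ k ∉ F, u k ≠ w k ∧ flip u k ∈ C ∧
      flip (flip u k) j ∈ C ∧
      ∀ x ∈ C, flip x j ∈ C → (∀ f ∈ F, x f = w f) → x k = u k → x = u := by
  classical
  obtain ⟨x₀, hx₀, hx₀j, hx₀F, hx₀w⟩ := hex
  let B := C.filter fun x => flip x j ∈ C ∧ ∀ f ∈ F, x f = w f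
  have hB {x} : x ∈ B ↔ x ∈ C ∧ flip x j ∈ C ∧ ∀ f ∈ F, x f = w f := Finset.mem_filter
  obtain ⟨u, hu, hmax⟩ := B.exists_max_image (hamming · w) ⟨x₀, hB.2 ⟨hx₀, hx₀j, hx₀F⟩⟩
  obtain ⟨huC, huj, huF⟩ := hB.1 hu
  have huw : u ≠ w := by
    rintro rfl
    have h1 := hmax x₀ (hB.2 ⟨hx₀, hx₀j, hx₀F⟩)
    obtain ⟨l, hl⟩ := Function.ne_iff.1 hx₀w
    have h2 := hamming_flip_lt hl
    have h3 : hamming u u = 0 := by simp [hamming]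
    omega
  obtain ⟨k, hk, hkc, hkjc⟩ :=
    hC.edges_isometric j u w huC huj hw hwj (huF j hj) huw
  have hkF : k ∉ F := fun h => hk (huF k h)
  refine ⟨u, huC, huj, huF, k, hkF, hk, hkc, hkjc, fun x hx hxj hxF hxk => ?_⟩
  by_contra hxu
  obtain ⟨l, hl, hlc, hljc⟩ := hC.edges_isometric j u x huC huj hx hxj
    ((huF j hj).trans (hxF j hj).symm) (Ne.symm hxu)
  have hlF : l ∉ F := fun h => hl ((huF l h).trans (hxF l h).symm)
  have hlk : l ≠ k := by rintro rfl; exact hl hxk.symm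
  have hjl : j ≠ l := by rintro rfl; exact hlF hj
  have hjk : j ≠ k := by rintro rfl; exact hkF hj
  have hlw : u l ≠ w l := by
    intro h
    have h1 := hmax (flip u l) (hB.2 ⟨hlc, hljc, fun f hf => by
      rw [flip_of_ne u (by rintro rfl; exact hlF hf), huF f hf]⟩)
    have h2 := lt_hamming_flip h
    omega
  have hsh : Shatters C {j, k, l} := by
    have key (b : Fin n → Bool) (z : Fin n → Bool) (hz : z ∈ C) (hzj : flip z j ∈ C)
        (h1 : z k = b k) (h2 : z l = b l) : ∃ c ∈ C, ∀ i ∈ ({j, k, l} : Finset _), c i = b i := by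
      simp only [Finset.mem_insert, Finset.mem_singleton, forall_eq_or_imp, forall_eq]
      by_cases h : z j = b j
      · exact ⟨z, hz, h, h1, h2⟩
      · refine ⟨flip z j, hzj, ?_, ?_, ?_⟩
        · rw [flip_self]
          cases h1 : z j <;> cases h2 : b j <;> simp_all
        · rwa [flip_of_ne z hjk.symm]
        · rwa [flip_of_ne z hjl.symm]
    have hne {a b c : Bool} (h1 : a ≠ b) (h2 : a ≠ c) : b = c := by
      cases a <;> cases b <;> cases c <;> simp_all
    intro p
    by_cases h1 : u k = p k <;> by_cases h2 : u l = p l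
    · exact key p u huC huj h1 h2
    · refine key p (flip u l) hlc hljc ?_ ?_
      · rwa [flip_of_ne u hlk.symm]
      · exact hne (by simp) h2
    · refine key p (flip u k) hkc hkjc ?_ ?_
      · exact hne (by simp) h1
      · rwa [flip_of_ne u hlk]
    · exact key p w hw hwj (hne hk h1) (hne hlw h2)
  have := hC.card_le _ hsh
  rw [Finset.card_eq_three.2 ⟨j, k, l, hjk, hjl, hlk.symm, rfl⟩] at this
  omega

lemma card_filter_lt_card_filter {C : Finset (Fin n → Bool)} {p q : (Fin n → Bool) → Prop}
    [DecidablePred p] [DecidablePred q] (h : ∀ x ∈ C, p x → q x) {w : Fin n → Bool}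
    (hw : w ∈ C) (hq : q w) (hp : ¬ p w) : (C.filter p).card < (C.filter q).card := by
  refine Finset.card_lt_card (Finset.ssubset_iff_of_subset ?_ |>.2 ⟨w, ?_, ?_⟩)
  · intro x hx
    rw [Finset.mem_filter] at hx ⊢
    exact ⟨hx.1, h x hx.1 hx.2⟩
  · simp [hw, hq]
  · simp [hp]

/-- Every proper halfspace of `C`, and every quadrant of `C` with a single vertex on one of its
two walls, yields a peak. -/
lemma IsTwoAmple.exists_peak_of_halfspace_and_quadrant {C : Finset (Fin n → Bool)}
    (hC : IsTwoAmple C) (N : ℕ) :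
    (∀ i, ∀ x ∈ C, ∀ y ∈ C, x i ≠ y i → (C.filter fun z => z i = x i).card = N →
      ∃ v, IsPeak C v) ∧
    (∀ i j w, i ≠ j → w ∈ C → flip w i ∈ C → flip w j ∈ C → flip (flip w i) j ∈ C →
      (∀ x ∈ C, x i = w i → x j = w j → flip x i ∈ C → x = w) →
      (C.filter fun z => z i = w i ∧ z j = w j).card = N → ∃ v, IsPeak C v) := by
  classical
  induction N using Nat.strong_induction_on with
  | _ N ih =>
    refine ⟨fun i x hx y hy hxy hN => ?_, fun i j w hij hw hwi hwj hwij huniq hN => ?_⟩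
    · obtain ⟨w, hw, hwi, -, l, hl, hli⟩ :=
        hC.isometric.exists_exit (fun z => z i = x i) hy hx rfl hxy.symm
      obtain rfl : i = l := by
        by_contra h
        exact hli (by rw [flip_of_ne w h, hwi])
      subst hN
      rw [← hwi] at ih
      by_cases hex : ∃ x ∈ C, flip x i ∈ C ∧ (∀ f ∈ ({i} : Finset (Fin n)), x f = w f) ∧ x ≠ w
      · obtain ⟨u, hu, hui, huF, k, hkF, hk, hkc, hkic, huniq⟩ :=
          hC.exists_leaf (Finset.mem_singleton_self i) hw hl hex
        simp only [Finset.mem_singleton, forall_eq] at huF hkF huniq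
        refine (ih _ ?_).2 i k u (Ne.symm hkF) hu hui hkc (by rwa [flip_comm]) ?_ rfl
        · exact card_filter_lt_card_filter (fun z _ hz => hz.1.trans huF) hw rfl
            fun h => hk h.2.symm
        · exact fun z hz h1 h2 h3 => huniq z hz h3 (h1.trans huF) h2
      · simp only [Finset.mem_singleton, forall_eq] at hex
        push Not at hex
        by_cases hH : ∃ z ∈ C, z i = w i ∧ z ≠ w
        · obtain ⟨z, hz, hzi, hzw⟩ := hH
          obtain ⟨k, hk⟩ := Function.ne_iff.1 hzw
          refine (ih _ ?_).1 k z hz w hw hk rfl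
          refine card_filter_lt_card_filter (fun t ht htk => ?_) hw rfl (Ne.symm hk)
          by_contra hti
          obtain ⟨s, hs, hsi, hsk, m, hm, hmi⟩ :=
            hC.isometric.exists_exit (fun z => z i = w i) ht hz hzi hti
          obtain rfl : i = m := by
            by_contra h
            exact hmi (by rw [flip_of_ne s h, hsi])
          obtain rfl := hex s hs hm hsi
          exact hk ((hsk k htk.symm).trans htk).symm
        · push Not at hH
          have hnb : ∀ m, flip w m ∈ C → m = i := by
            intro m hm
            by_contra hmi
            exact flip_ne w m (hH _ hm (flip_of_ne w (Ne.symm hmi)))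
          refine ⟨w, hw, fun a b hab ha hb => absurd ((hnb a ha).trans (hnb b hb).symm) hab, ?_⟩
          refine (Finset.card_le_card (t := {i}) fun m hm => ?_).trans (by simp)
          simpa using hnb m (Finset.mem_filter.1 hm).2
    · subst hN
      by_cases hex : ∃ x ∈ C, flip x j ∈ C ∧ (∀ f ∈ ({i, j} : Finset (Fin n)), x f = w f) ∧ x ≠ w
      · obtain ⟨u, hu, huj, huF, k, hkF, hk, hkc, hkjc, huniq'⟩ :=
          hC.exists_leaf (by simp) hw hwj hex
        simp only [Finset.mem_insert, Finset.mem_singleton, forall_eq_or_imp, forall_eq,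
          not_or] at huF hkF huniq'
        have hside : ∀ x ∈ C, x j = u j → x k = u k → x i = w i := by
          intro x hx hxj hxk
          by_contra hxi
          obtain ⟨s, hs, hsi, hsk, m, hm, hmi⟩ :=
            hC.isometric.exists_exit (fun z => z i = w i) hx hu huF.1 hxi
          obtain rfl : i = m := by
            by_contra h
            exact hmi (by rw [flip_of_ne s h, hsi])
          have := huniq s hs hsi ((hsk j hxj.symm).trans (hxj.trans huF.2)) hm
          subst this
          exact hk ((hsk k hxk.symm).trans hxk).symm
        refine (ih _ ?_).2 j k u (Ne.symm hkF.2) hu huj hkc (by rwa [flip_comm]) ?_ rfl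
        · exact card_filter_lt_card_filter
            (fun z hz h => ⟨hside z hz h.1 h.2, h.1.trans huF.2⟩) hw ⟨rfl, rfl⟩
            fun h => hk h.2.symm
        · exact fun z hz h1 h2 h3 =>
            huniq' z hz h3 ⟨hside z hz h1 h2, h1.trans huF.2⟩ h2
      · simp only [Finset.mem_insert, Finset.mem_singleton, forall_eq_or_imp, forall_eq] at hex
        push Not at hex
        by_cases hQ : ∃ z ∈ C, (z i = w i ∧ z j = w j) ∧ z ≠ w
        · obtain ⟨z, hz, hzi, hzw⟩ := hQ
          obtain ⟨k, hk⟩ := Function.ne_iff.1 hzw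
          refine (ih _ ?_).1 k z hz w hw hk rfl
          refine card_filter_lt_card_filter (fun t ht htk => ?_) hw ⟨rfl, rfl⟩ (Ne.symm hk)
          by_contra hti
          obtain ⟨s, hs, hsi, hsk, m, hm, hmi⟩ :=
            hC.isometric.exists_exit (fun z => z i = w i ∧ z j = w j) ht hz hzi hti
          have hsw : s = w := by
            by_cases hmi' : i = m
            · subst hmi'
              exact huniq s hs hsi.1 hsi.2 hm
            · by_cases hmj : j = m
              · subst hmj
                exact hex s hs hm hsi
              · exact absurd ⟨by rw [flip_of_ne s hmi', hsi.1],
                  by rw [flip_of_ne s hmj, hsi.2]⟩ hmi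
          subst hsw
          exact hk ((hsk k htk.symm).trans htk).symm
        · push Not at hQ
          have hnb : ∀ m, flip w m ∈ C → m = i ∨ m = j := by
            intro m hm
            by_contra! hmi
            exact flip_ne w m (hQ _ hm ⟨flip_of_ne w hmi.1.symm, flip_of_ne w hmi.2.symm⟩)
          refine ⟨w, hw, fun a b hab ha hb => ?_, ?_⟩
          · rcases hnb a ha with rfl | rfl <;> rcases hnb b hb with rfl | rfl
            · exact absurd rfl hab
            · exact hwij
            · rwa [flip_comm]
            · exact absurd rfl hab
          · refine (Finset.card_le_card (t := {i, j}) fun m hm => ?_).trans Finset.card_le_two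
            simpa using hnb m (Finset.mem_filter.1 hm).2

lemma IsTwoAmple.exists_peak {C : Finset (Fin n → Bool)} (hC : IsTwoAmple C)
    (hne : C.Nonempty) : ∃ v, IsPeak C v := by
  obtain ⟨x, hx⟩ := hne
  by_cases h : ∃ y ∈ C, x ≠ y
  · obtain ⟨y, hy, hxy⟩ := h
    obtain ⟨i, hi⟩ := Function.ne_iff.1 hxy
    exact (hC.exists_peak_of_halfspace_and_quadrant _).1 i x hx y hy hi rfl
  · push Not at h
    have hnb : ∀ m, flip x m ∉ C := fun m hm => flip_ne x m (h _ hm).symm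
    exact ⟨x, hx, fun i _ _ hi => absurd hi (hnb i), by simp [hnb]⟩

lemma IsPeak.isCorner {C : Finset (Fin n → Bool)} {v : Fin n → Bool} (hv : IsPeak C v) :
    IsCorner C v := by
  classical
  set I : Finset (Fin n) := Finset.univ.filter fun i => flip v i ∈ C with hI
  set Q : Finset (Fin n → Bool) := Finset.univ.filter fun u => ∀ i, i ∉ I → u i = v i with hQ
  have hmemI {i : Fin n} : i ∈ I ↔ flip v i ∈ C := by simp [hI]
  have hmemQ {u : Fin n → Bool} : u ∈ Q ↔ ∀ i, i ∉ I → u i = v i := by simp [hQ]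
  have hneg {a b : Bool} (h : a ≠ b) : a = !b := by cases a <;> cases b <;> simp_all
  have hQC : Q ⊆ C := by
    intro u hu
    rw [hmemQ] at hu
    set D : Finset (Fin n) := Finset.univ.filter fun i => u i ≠ v i with hD
    have hmemD {i : Fin n} : i ∈ D ↔ u i ≠ v i := by simp [hD]
    have hDI : D ⊆ I := fun i hi => by
      by_contra h
      exact hmemD.1 hi (hu i h)
    have hD2 : D.card ≤ 2 := (Finset.card_le_card hDI).trans hv.card_le
    obtain h | h | h : D.card = 0 ∨ D.card = 1 ∨ D.card = 2 := by omega
    · have : u = v := funext fun i => by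
        by_contra hc
        rw [Finset.card_eq_zero] at h
        simpa [h] using hmemD.2 hc
      exact this ▸ hv.mem
    · obtain ⟨i, hi⟩ := exists_eq_flip_of_adj (u := u) (v := v) h
      have hiD : i ∈ D := hmemD.2 (by simp [hi])
      exact hi ▸ hmemI.1 (hDI hiD)
    · obtain ⟨i, j, hij, hDij⟩ := Finset.card_eq_two.1 h
      have hiD : i ∈ D := by simp [hDij]
      have hjD : j ∈ D := by simp [hDij]
      have : u = flip (flip v i) j := funext fun k => by
        by_cases hkj : k = j
        · subst hkj
          rw [flip_self, flip_of_ne v hij.symm]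
          exact hneg (hmemD.1 hjD)
        · rw [flip_of_ne _ hkj]
          by_cases hki : k = i
          · subst hki
            rw [flip_self]
            exact hneg (hmemD.1 hiD)
          · rw [flip_of_ne _ hki]
            by_contra hc
            have := hmemD.2 hc
            simp [hDij, hki, hkj] at this
      exact this ▸ hv.square i j hij (hmemI.1 (hDI hiD)) (hmemI.1 (hDI hjD))
  have hvQ : v ∈ Q := hmemQ.2 fun _ _ => rfl
  have hcolors : ∀ Q' I', IsCube C Q' I' → v ∈ Q' → I' ⊆ I := by
    intro Q' I' hcube hvQ' i hi
    obtain ⟨u, hu, hup⟩ := hcube.2.2 (flip v i)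
    have : u = flip v i := funext fun k => by
      by_cases hk : k ∈ I'
      · exact hup k hk
      · rw [flip_of_ne v (by rintro rfl; exact hk hi)]
        exact hcube.2.1 u hu v hvQ' k hk
    exact hmemI.2 (this ▸ hcube.1 hu)
  refine ⟨Q, I, ⟨hQC, ?_, ?_⟩, hvQ, ?_, ?_, ?_⟩
  · intro u hu w hw i hi
    rw [hmemQ.1 hu i hi, hmemQ.1 hw i hi]
  · intro p
    exact ⟨fun i => if i ∈ I then p i else v i, hmemQ.2 fun i hi => by simp [hi],
      fun i hi => by simp [hi]⟩
  · exact fun Q' I' hcube hvQ' => Finset.card_le_card (hcolors Q' I' hcube hvQ')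
  · intro Q' I' hcube hvQ' hcard
    have hI' := Finset.eq_of_subset_of_card_le (hcolors Q' I' hcube hvQ') hcard.ge
    rw [hI'] at hcube
    ext u
    rw [hmemQ]
    constructor
    · exact fun hu i hi => hcube.2.1 u hu v hvQ' i hi
    · intro hu
      obtain ⟨z, hz, hzp⟩ := hcube.2.2 u
      have : z = u := funext fun k => by
        by_cases hk : k ∈ I
        · exact hzp k hk
        · rw [hcube.2.1 z hz v hvQ' k hk, hu k hk]
      exact this ▸ hz
  · intro u hu hadj
    obtain ⟨i, rfl⟩ := exists_eq_flip_of_adj hadj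
    refine hmemQ.2 fun k hk => flip_of_ne v ?_
    rintro rfl
    exact hk (hmemI.2 hu)

lemma IsMaximum.isExtremal {C : Finset (Fin n → Bool)} {d : ℕ} (hC : IsMaximum C d) :
    IsExtremal C := by
  classical
  unfold IsExtremal
  rw [hC.2]
  have : shattered C ⊆ (Finset.range (d + 1)).biUnion fun i =>
      Finset.powersetCard i (Finset.univ : Finset (Fin n)) := by
    intro S hS
    have := hC.1.2 S (mem_shattered.1 hS)
    simp only [Finset.mem_biUnion, Finset.mem_range, Finset.mem_powersetCard]
    exact ⟨S.card, by omega, Finset.subset_univ S, rfl⟩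
  refine (Finset.card_le_card this).trans (Finset.card_biUnion_le.trans ?_)
  simp

lemma IsTwoAmple.exists_isCornerPeeling {C : Finset (Fin n → Bool)} (hC : IsTwoAmple C) :
    ∃ v : Fin C.card → (Fin n → Bool), IsCornerPeeling C v := by
  classical
  have hpick : ∀ D : Finset (Fin n → Bool), ∃ v, IsTwoAmple D → D.Nonempty → IsPeak D v := by
    intro D
    by_cases h : IsTwoAmple D ∧ D.Nonempty
    · obtain ⟨v, hv⟩ := h.1.exists_peak h.2
      exact ⟨v, fun _ _ => hv⟩
    · exact ⟨fun _ => false, fun h1 h2 => absurd ⟨h1, h2⟩ h⟩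
  choose pick hpick using hpick
  let S : ℕ → Finset (Fin n → Bool) := fun t => (fun D => D.erase (pick D))^[t] C
  have hsucc (t : ℕ) : S (t + 1) = (S t).erase (pick (S t)) :=
    Function.iterate_succ_apply' _ _ _
  have hpeel (t : ℕ) : IsTwoAmple (S t) := by
    induction t with
    | zero => exact hC
    | succ t ih =>
      rw [hsucc]
      rcases (S t).eq_empty_or_nonempty with h | h
      · rw [h, Finset.erase_empty, ← h]
        exact ih
      · exact ih.erase (hpick _ ih h)
  have hcard (t : ℕ) : C.card ≤ (S t).card + t := by
    induction t with
    | zero => exact le_rfl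
    | succ t ih =>
      have := Finset.pred_card_le_card_erase (s := S t) (a := pick (S t))
      rw [hsucc]
      omega
  have hanti : Antitone S := antitone_nat_of_succ_le fun t => by
    rw [hsucc]
    exact Finset.erase_subset _ _
  have hpeak (t : Fin C.card) : IsPeak (S t) (pick (S t)) := by
    refine hpick _ (hpeel t) (Finset.card_pos.1 ?_)
    have := hcard t
    omega
  have hmem (t : ℕ) (x : Fin n → Bool) : x ∈ S t ↔ x ∈ C ∧ ∀ s < t, x ≠ pick (S s) := by
    induction t with
    | zero => simp [S]
    | succ t ih =>
      rw [hsucc, Finset.mem_erase, ih]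
      constructor
      · rintro ⟨h1, h2, h3⟩
        refine ⟨h2, fun s hs => ?_⟩
        rcases Nat.lt_succ_iff_lt_or_eq.1 hs with h | rfl
        · exact h3 s h
        · exact h1
      · rintro ⟨h1, h2⟩
        exact ⟨h2 t (by omega), h1, fun s hs => h2 s (by omega)⟩
  refine ⟨fun t => pick (S t), ?_, fun t => ?_, fun t => ?_⟩
  · have hlt {s t : Fin C.card} (hst : s < t) : pick (S t) ≠ pick (S s) :=
      ((hmem t _).1 (hpeak t).mem).2 s hst
    intro s t h
    rcases lt_trichotomy s t with hst | hst | hst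
    · exact absurd h.symm (hlt hst)
    · exact hst
    · exact absurd h (hlt hst)
  · exact hanti (Nat.zero_le t) (hpeak t).mem
  · have : Peeled C (fun t : Fin C.card => pick (S t)) t = S t := by
      ext x
      rw [hmem]
      simp only [Peeled, Finset.mem_sdiff, Finset.mem_image, Finset.mem_filter, Finset.mem_univ,
        true_and, not_exists, not_and]
      refine and_congr_right fun _ => ⟨fun h s hs heq => ?_, fun h s hs heq => ?_⟩
      · exact h ⟨s, hs.trans t.2⟩ hs heq.symm
      · exact h s hs heq.symm
    rw [this]
    exact (hpeak t).isCorner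

/-- Every `2`-maximum class `C ⊆ {0,1}^n` (`n ≥ 2`) can be
corner-peeled. -/
theorem stmt13 (n : ℕ) (hn : 2 ≤ n) (C : Finset (Fin n → Bool)) (hC : IsMaximum C 2) :
    ∃ v : Fin C.card → (Fin n → Bool), IsCornerPeeling C v :=
  (hC.isExtremal.isTwoAmple hC.1.2).exists_isCornerPeeling

end GeomCompress
end

section
/- Let 1 ≤ d ≤ n−1 and let C* ⊆ {0,1}^n be d-maximum. Let C ⊆ {0,1}^{n−1} be the projection of C* onto the first n−1 coordinates and let C' be the reduction of C* in the n-th coordinate. Then C is d-maximum, C' is (d−1)-maximum with C' ⊆ C, and there exists p ∈ {0,1}^k, where C_1,…,C_k are the C'-connected components of C, such that C* = (C' × {0,1}) ∪ ⋃_{q=1}^{k} (C_q × {p_q}). -/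
open Finset

namespace GeomCompress

section Families

variable {α : Type*}

/-- The cube through `w` with directions `I` is contained in `𝒜`. -/
def HasCube (𝒜 : Finset (Finset α)) (w I : Finset α) : Prop :=
  ∀ x, (∀ i, i ∉ I → (i ∈ x ↔ i ∈ w)) → x ∈ 𝒜

theorem HasCube.mem {𝒜 : Finset (Finset α)} {w I : Finset α} (h : HasCube 𝒜 w I) : w ∈ 𝒜 :=
  h _ (by simp)

theorem hasCube_empty {𝒜 : Finset (Finset α)} {w : Finset α} (hw : w ∈ 𝒜) : HasCube 𝒜 w ∅ := by
  intro x hx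
  rwa [show x = w from ext fun i => hx i (notMem_empty i)]

variable [DecidableEq α]

/-- The projection of a set family away from the point `a`. -/
def proj (a : α) (𝒜 : Finset (Finset α)) : Finset (Finset α) :=
  𝒜.nonMemberSubfamily a ∪ 𝒜.memberSubfamily a

/-- The reduction of a set family at the point `a`. -/
def red (a : α) (𝒜 : Finset (Finset α)) : Finset (Finset α) :=
  𝒜.nonMemberSubfamily a ∩ 𝒜.memberSubfamily a

theorem mem_proj {a : α} {𝒜 : Finset (Finset α)} {s : Finset α} :
    s ∈ proj a 𝒜 ↔ a ∉ s ∧ (s ∈ 𝒜 ∨ insert a s ∈ 𝒜) := by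
  simp only [proj, mem_union, mem_nonMemberSubfamily, mem_memberSubfamily]; tauto

theorem mem_red {a : α} {𝒜 : Finset (Finset α)} {s : Finset α} :
    s ∈ red a 𝒜 ↔ a ∉ s ∧ s ∈ 𝒜 ∧ insert a s ∈ 𝒜 := by
  simp only [red, mem_inter, mem_nonMemberSubfamily, mem_memberSubfamily]; tauto

theorem card_proj_add_card_red (a : α) (𝒜 : Finset (Finset α)) :
    (proj a 𝒜).card + (red a 𝒜).card = 𝒜.card := by
  rw [proj, red, card_union_add_card_inter, add_comm,
    card_memberSubfamily_add_card_nonMemberSubfamily]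

/-- `𝒜` is a family of subsets of `S` of the maximum possible size among those that only shatter
sets of size less than `k`. -/
structure IsMaxFamily (S : Finset α) (k : ℕ) (𝒜 : Finset (Finset α)) : Prop where
  subset : ∀ s ∈ 𝒜, s ⊆ S
  card_lt : ∀ t, 𝒜.Shatters t → t.card < k
  card_eq : 𝒜.card = ∑ i ∈ range k, S.card.choose i

theorem subset_of_shatters {S : Finset α} {𝒜 : Finset (Finset α)} (hS : ∀ s ∈ 𝒜, s ⊆ S)
    {t : Finset α} (ht : 𝒜.Shatters t) : t ⊆ S := by
  obtain ⟨u, hu, h⟩ := ht.exists_superset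
  exact h.trans (hS u hu)

theorem card_biUnion_powersetCard (S : Finset α) (k : ℕ) :
    ((range k).biUnion fun i => S.powersetCard i).card = ∑ i ∈ range k, S.card.choose i := by
  rw [card_biUnion]
  · simp
  · intro i _ j _ hij
    exact pairwise_disjoint_powersetCard S hij

theorem shatterer_subset {S : Finset α} {k : ℕ} {𝒜 : Finset (Finset α)}
    (hS : ∀ s ∈ 𝒜, s ⊆ S) (hk : ∀ t, 𝒜.Shatters t → t.card < k) :
    𝒜.shatterer ⊆ (range k).biUnion fun i => S.powersetCard i := by
  intro t ht
  rw [mem_shatterer] at ht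
  simp only [mem_biUnion, mem_range, mem_powersetCard]
  exact ⟨t.card, hk t ht, subset_of_shatters hS ht, rfl⟩

theorem card_le_sum_choose {S : Finset α} {k : ℕ} {𝒜 : Finset (Finset α)}
    (hS : ∀ s ∈ 𝒜, s ⊆ S) (hk : ∀ t, 𝒜.Shatters t → t.card < k) :
    𝒜.card ≤ ∑ i ∈ range k, S.card.choose i := by
  rw [← card_biUnion_powersetCard]
  exact 𝒜.card_le_card_shatterer.trans (card_le_card (shatterer_subset hS hk))

theorem IsMaxFamily.shatters {S : Finset α} {k : ℕ} {𝒜 : Finset (Finset α)}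
    (h : IsMaxFamily S k 𝒜) {t : Finset α} (htS : t ⊆ S) (ht : t.card < k) : 𝒜.Shatters t := by
  have heq : 𝒜.shatterer = (range k).biUnion fun i => S.powersetCard i := by
    refine eq_of_subset_of_card_le (shatterer_subset h.subset h.card_lt) ?_
    rw [card_biUnion_powersetCard, ← h.card_eq]
    exact 𝒜.card_le_card_shatterer
  rw [← mem_shatterer, heq]
  simp only [mem_biUnion, mem_range, mem_powersetCard]
  exact ⟨t.card, ht, htS, rfl⟩

theorem shatters_of_shatters_proj {a : α} {𝒜 : Finset (Finset α)} {t : Finset α}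
    (ht : (proj a 𝒜).Shatters t) : 𝒜.Shatters t := by
  have hat : a ∉ t := by
    obtain ⟨u, hu, h⟩ := ht.exists_superset
    exact fun hat => (mem_proj.1 hu).1 (h hat)
  intro s hs
  obtain ⟨u, hu, rfl⟩ := ht hs
  obtain ⟨hau, hu | hu⟩ := mem_proj.1 hu
  · exact ⟨u, hu, rfl⟩
  · exact ⟨_, hu, inter_insert_of_notMem hat⟩

theorem notMem_of_shatters_red {a : α} {𝒜 : Finset (Finset α)} {t : Finset α}
    (ht : (red a 𝒜).Shatters t) : a ∉ t := by
  obtain ⟨u, hu, h⟩ := ht.exists_superset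
  exact fun hat => (mem_red.1 hu).1 (h hat)

theorem shatters_insert_of_shatters_red {a : α} {𝒜 : Finset (Finset α)} {t : Finset α}
    (ht : (red a 𝒜).Shatters t) : 𝒜.Shatters (insert a t) := by
  have hat := notMem_of_shatters_red ht
  intro s hs
  obtain ⟨u, hu, h⟩ := ht (t := s.erase a) (by grind)
  obtain ⟨hau, hu, hu'⟩ := mem_red.1 hu
  by_cases has : a ∈ s
  · exact ⟨_, hu', by grind⟩
  · exact ⟨u, hu, by grind⟩

theorem sum_range_choose_succ (m k : ℕ) :
    ∑ i ∈ range (k + 1), (m + 1).choose i =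
      ∑ i ∈ range (k + 1), m.choose i + ∑ i ∈ range k, m.choose i := by
  rw [sum_range_succ', sum_range_succ' (fun i => m.choose i)]
  simp only [Nat.choose_succ_succ', sum_add_distrib, Nat.choose_zero_right]
  omega

theorem IsMaxFamily.proj_red {S : Finset α} {k : ℕ} {𝒜 : Finset (Finset α)}
    (h : IsMaxFamily S (k + 1) 𝒜) {a : α} (ha : a ∈ S) :
    IsMaxFamily (S.erase a) (k + 1) (proj a 𝒜) ∧ IsMaxFamily (S.erase a) k (red a 𝒜) := by
  have hpS : ∀ s ∈ proj a 𝒜, s ⊆ S.erase a := by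
    intro s hs
    obtain ⟨has, hs | hs⟩ := mem_proj.1 hs <;> have := h.subset _ hs <;> grind
  have hrS : ∀ s ∈ red a 𝒜, s ⊆ S.erase a := by
    intro s hs
    obtain ⟨has, hs, -⟩ := mem_red.1 hs
    have := h.subset _ hs
    grind
  have hpk : ∀ t, (proj a 𝒜).Shatters t → t.card < k + 1 :=
    fun t ht => h.card_lt t (shatters_of_shatters_proj ht)
  have hrk : ∀ t, (red a 𝒜).Shatters t → t.card < k := by
    intro t ht
    have := h.card_lt _ (shatters_insert_of_shatters_red ht)
    rw [card_insert_of_notMem (notMem_of_shatters_red ht)] at this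
    omega
  have hp := card_le_sum_choose hpS hpk
  have hr := card_le_sum_choose hrS hrk
  have hcard := card_proj_add_card_red a 𝒜
  rw [h.card_eq, ← card_erase_add_one ha, sum_range_choose_succ] at hcard
  exact ⟨⟨hpS, hpk, by omega⟩, ⟨hrS, hrk, by omega⟩⟩

theorem IsMaxFamily.red_proj {S : Finset α} {k : ℕ} {𝒜 : Finset (Finset α)}
    (h : IsMaxFamily S (k + 2) 𝒜) {a b : α} (ha : a ∈ S) (hb : b ∈ S) (hab : a ≠ b) :
    red a (proj b 𝒜) = proj b (red a 𝒜) := by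
  symm
  refine eq_of_subset_of_card_le ?_ ?_
  · intro s hs
    have := insert_comm a b s
    simp only [mem_proj, mem_red] at hs ⊢
    grind
  · have h₁ := ((h.proj_red hb).1.proj_red (mem_erase.2 ⟨hab, ha⟩)).2.card_eq
    have h₂ := ((h.proj_red ha).2.proj_red (mem_erase.2 ⟨hab.symm, hb⟩)).1.card_eq
    rw [h₁, h₂, erase_right_comm]

theorem HasCube.union_mem {𝒜 : Finset (Finset α)} {w I : Finset α} (h : HasCube 𝒜 w I) :
    w ∪ I ∈ 𝒜 := h _ (by grind)

theorem hasCube_red {a : α} {𝒜 : Finset (Finset α)} {w I : Finset α} (ha : a ∉ I) :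
    HasCube (red a 𝒜) (w.erase a) I ↔ HasCube 𝒜 w (insert a I) := by
  constructor
  · intro h x hx
    have := mem_red.1 (h (x.erase a) (by grind))
    by_cases hax : a ∈ x
    · rw [insert_erase hax] at this
      exact this.2.2
    · rw [erase_eq_of_notMem hax] at this
      exact this.2.1
  · intro h x hx
    exact mem_red.2 ⟨by grind, h _ (by grind), h _ (by grind)⟩

/-- Small cubes of the projection of a maximum family lift to cubes of the family. -/
theorem IsMaxFamily.hasCube_of_proj {I S : Finset α} {d : ℕ} {𝒜 : Finset (Finset α)}
    {w : Finset α} {b : α} (h : IsMaxFamily S (d + 1) 𝒜) (hb : b ∈ S) (hI : I.card ≤ d)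
    (hw : HasCube (proj b 𝒜) w I) : HasCube 𝒜 w I ∨ HasCube 𝒜 (insert b w) I := by
  induction I using Finset.induction generalizing S d 𝒜 w with
  | empty =>
    exact (mem_proj.1 hw.mem).2.imp hasCube_empty hasCube_empty
  | insert a I ha ih =>
    rw [card_insert_of_notMem ha] at hI
    obtain ⟨d, rfl⟩ : ∃ e, d = e + 1 := ⟨d - 1, by omega⟩
    have hab : a ≠ b ∧ a ∈ S := mem_erase.1 <|
      (h.proj_red hb).1.subset _ hw.union_mem (mem_union_right _ (mem_insert_self a I))
    rw [← hasCube_red ha, h.red_proj hab.2 hb hab.1] at hw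
    rw [← hasCube_red ha, ← hasCube_red ha, erase_insert_of_ne hab.1.symm]
    exact ih (h.proj_red hab.2).2 (mem_erase.2 ⟨hab.1.symm, hb⟩) (by omega) hw

/-- Every member of a maximum family lies in a cube of maximum dimension. -/
theorem IsMaxFamily.exists_hasCube {S : Finset α} {d : ℕ} {𝒜 : Finset (Finset α)}
    {w : Finset α} (h : IsMaxFamily S (d + 1) 𝒜) (hd : d ≤ S.card) (hw : w ∈ 𝒜) :
    ∃ I, I.card = d ∧ HasCube 𝒜 w I := by
  induction S using Finset.induction generalizing d 𝒜 w with
  | empty => exact ⟨∅, by simpa [eq_comm] using hd, hasCube_empty hw⟩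
  | insert a S ha ih =>
    obtain rfl | ⟨d, rfl⟩ : d = 0 ∨ ∃ e, d = e + 1 := by cases d <;> simp
    · exact ⟨∅, rfl, hasCube_empty hw⟩
    obtain hlt | heq := hd.lt_or_eq
    · rw [card_insert_of_notMem ha] at hlt
      obtain ⟨hp, hr⟩ := h.proj_red (mem_insert_self a S)
      rw [erase_insert ha] at hp hr
      have hcase (v : Finset α) (hv : v ∈ 𝒜) (hv' : v ≠ w) (he : v.erase a = w.erase a) :
          ∃ J, J.card = d + 1 ∧ HasCube 𝒜 w J := by
        have hmem : w.erase a ∈ red a 𝒜 := by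
          refine mem_red.2 ⟨notMem_erase a w, ?_⟩
          by_cases haw : a ∈ w
          · have hav : a ∉ v := fun hav => hv' (by rw [← insert_erase hav, he, insert_erase haw])
            rw [insert_erase haw, ← he, erase_eq_of_notMem hav]
            exact ⟨hv, hw⟩
          · have hav : a ∈ v := by
              by_contra hav
              rw [erase_eq_of_notMem hav, erase_eq_of_notMem haw] at he
              exact hv' he
            rw [← he, insert_erase hav, he, erase_eq_of_notMem haw]
            exact ⟨hw, hv⟩
        obtain ⟨J, hJ, hcube⟩ := ih hr (by omega) hmem
        have haJ : a ∉ J := fun haJ =>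
          (mem_red.1 hcube.union_mem).1 (mem_union_right _ haJ)
        exact ⟨insert a J, by rw [card_insert_of_notMem haJ, hJ], (hasCube_red haJ).1 hcube⟩
      have hmem : w.erase a ∈ proj a 𝒜 := by
        refine mem_proj.2 ⟨notMem_erase a w, ?_⟩
        by_cases haw : a ∈ w
        · exact .inr (by rwa [insert_erase haw])
        · exact .inl (by rwa [erase_eq_of_notMem haw])
      obtain ⟨I, hI, hcube⟩ := ih hp (by omega) hmem
      obtain ⟨v, he, hv⟩ : ∃ v, v.erase a = w.erase a ∧ HasCube 𝒜 v I := by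
        obtain hv | hv := h.hasCube_of_proj (mem_insert_self a S) hI.le hcube
        · exact ⟨_, erase_idem, hv⟩
        · exact ⟨_, erase_insert (notMem_erase a w), hv⟩
      obtain rfl | hne := eq_or_ne v w
      · exact ⟨I, hI, hv⟩
      · exact hcase v hv.mem hne he
    · have hall : 𝒜 = (insert a S).powerset := by
        refine eq_of_subset_of_card_le (fun s hs => mem_powerset.2 (h.subset s hs)) ?_
        rw [h.card_eq, heq, Nat.sum_range_choose, card_powerset]
      refine ⟨insert a S, heq.symm, fun x hx => ?_⟩
      have := h.subset w hw
      rw [hall, mem_powerset]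
      grind

end Families

section Encoding

variable {m : ℕ} {α : Type*}

/-- The image under `e` of the set of coordinates at which `c` is `true`. -/
def enc (e : Fin m ↪ α) (c : Fin m → Bool) : Finset α :=
  (univ.filter fun i => c i = true).map e

theorem mem_enc {e : Fin m ↪ α} {c : Fin m → Bool} {x : α} :
    x ∈ enc e c ↔ ∃ i, c i = true ∧ e i = x := by
  simp [enc]

theorem apply_mem_enc {e : Fin m ↪ α} {c : Fin m → Bool} {i : Fin m} :
    e i ∈ enc e c ↔ c i = true := by
  simp [enc]

theorem enc_injective (e : Fin m ↪ α) : Function.Injective (enc e) := by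
  intro c c' h
  funext i
  rw [Bool.eq_iff_iff, ← apply_mem_enc (e := e), h, apply_mem_enc]

theorem enc_subset (e : Fin m ↪ α) (c : Fin m → Bool) : enc e c ⊆ univ.map e :=
  map_subset_map.2 (subset_univ _)

theorem exists_enc_eq {e : Fin m ↪ α} {s : Finset α} (hs : s ⊆ univ.map e) :
    ∃ c, enc e c = s := by
  obtain ⟨u, -, rfl⟩ := subset_map_iff.1 hs
  exact ⟨fun i => decide (i ∈ u), by simp [enc]⟩

variable [DecidableEq α]

theorem enc_mem_image {e : Fin m ↪ α} {C : Finset (Fin m → Bool)} {c : Fin m → Bool} :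
    enc e c ∈ C.image (enc e) ↔ c ∈ C :=
  (enc_injective e).mem_finset_image

theorem image_enc_subset (e : Fin m ↪ α) (C : Finset (Fin m → Bool)) :
    ∀ s ∈ C.image (enc e), s ⊆ univ.map e := by
  intro s hs
  obtain ⟨c, -, rfl⟩ := mem_image.1 hs
  exact enc_subset e c

theorem shatters_image_enc {e : Fin m ↪ α} {C : Finset (Fin m → Bool)} {Y : Finset (Fin m)} :
    (C.image (enc e)).Shatters (Y.map e) ↔ Shatters C Y := by
  constructor
  · intro h p
    obtain ⟨u, hu, huY⟩ := h (map_subset_map.2 (filter_subset (fun i => p i = true) Y))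
    obtain ⟨c, hc, rfl⟩ := mem_image.1 hu
    refine ⟨c, hc, fun i hi => ?_⟩
    have := Finset.ext_iff.1 huY (e i)
    simp only [mem_inter, mem_map', apply_mem_enc, mem_filter, hi, true_and] at this
    exact Bool.eq_iff_iff.2 this
  · intro h t ht
    obtain ⟨u, hu, rfl⟩ := subset_map_iff.1 ht
    obtain ⟨c, hc, hcu⟩ := h fun i => decide (i ∈ u)
    refine ⟨enc e c, mem_image_of_mem _ hc, ?_⟩
    rw [enc, ← map_inter]
    congr 1
    ext i
    have := hcu i
    have := @hu i
    grind

theorem isMaximum_iff (e : Fin m ↪ α) {C : Finset (Fin m → Bool)} {d : ℕ} :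
    IsMaximum C d ↔ d ≤ m ∧ IsMaxFamily (univ.map e) (d + 1) (C.image (enc e)) := by
  have hcard : (C.image (enc e)).card = C.card := card_image_of_injective _ (enc_injective e)
  have huniv : (univ.map e).card = m := by simp
  constructor
  · rintro ⟨⟨⟨Y, hY, -⟩, hC⟩, hsum⟩
    refine ⟨?_, image_enc_subset e C, fun t ht => ?_, by rw [hcard, huniv, hsum]⟩
    · simpa [hY] using card_le_univ Y
    · obtain ⟨Y, -, rfl⟩ := subset_map_iff.1 (subset_of_shatters (image_enc_subset e C) ht)
      rw [card_map]
      exact Nat.lt_succ_of_le (hC Y (shatters_image_enc.1 ht))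
  · rintro ⟨hd, h⟩
    refine ⟨⟨?_, fun Y hY => ?_⟩, by rw [← hcard, h.card_eq, huniv]⟩
    · obtain ⟨Y, -, hY⟩ := exists_subset_card_eq (s := (univ : Finset (Fin m))) (by simpa using hd)
      refine ⟨Y, hY, shatters_image_enc.1 (h.shatters (map_subset_map.2 (subset_univ Y)) ?_)⟩
      rw [card_map]
      omega
    · simpa [Nat.lt_succ_iff] using h.card_lt _ (shatters_image_enc (e := e).2 hY)

theorem IsCube.mem_of_agree {C Q : Finset (Fin m → Bool)} {I : Finset (Fin m)}
    (h : IsCube C Q I) {u c : Fin m → Bool} (hu : u ∈ Q) (hc : ∀ i, i ∉ I → c i = u i) :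
    c ∈ Q := by
  obtain ⟨v, hv, hvc⟩ := h.2.2 c
  suffices c = v from this ▸ hv
  funext i
  by_cases hi : i ∈ I
  · exact (hvc i hi).symm
  · rw [hc i hi, h.2.1 u hu v hv i hi]

theorem IsCube.hasCube (e : Fin m ↪ α) {C Q : Finset (Fin m → Bool)} {I : Finset (Fin m)}
    (h : IsCube C Q I) {u : Fin m → Bool} (hu : u ∈ Q) :
    HasCube (C.image (enc e)) (enc e u) (I.map e) := by
  intro x hx
  obtain ⟨c, rfl⟩ : ∃ c, enc e c = x := by
    refine exists_enc_eq fun y hy => ?_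
    by_cases hyI : y ∈ I.map e
    · exact map_subset_map.2 (subset_univ I) hyI
    · exact enc_subset e u ((hx y hyI).1 hy)
  refine enc_mem_image.2 (h.1 (h.mem_of_agree hu fun i hi => ?_))
  rw [Bool.eq_iff_iff, ← apply_mem_enc (e := e), hx _ (by simpa using hi), apply_mem_enc]

theorem exists_isCube_of_hasCube {e : Fin m ↪ α} {C : Finset (Fin m → Bool)}
    {w : Fin m → Bool} {J : Finset α} (h : HasCube (C.image (enc e)) (enc e w) J) :
    ∃ Q I, IsCube C Q I ∧ I.card = J.card ∧ w ∈ Q := by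
  obtain ⟨I, -, rfl⟩ := subset_map_iff.1 <|
    subset_union_right.trans (image_enc_subset e C _ h.union_mem)
  refine ⟨univ.filter fun c => ∀ i, i ∉ I → c i = w i, I, ⟨?_, ?_, fun p => ?_⟩, by simp, by simp⟩
  · intro c hc
    rw [mem_filter_univ] at hc
    refine enc_mem_image.1 (h _ fun x hx => ?_)
    simp only [mem_enc]
    refine exists_congr fun i => and_congr_left ?_
    rintro rfl
    rw [hc i (by simpa using hx)]
  · intro u hu v hv i hi
    rw [mem_filter_univ] at hu hv
    rw [hu i hi, hv i hi]
  · refine ⟨fun i => if i ∈ I then p i else w i, ?_, fun i hi => by simp [hi]⟩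
    rw [mem_filter_univ]
    intro i hi
    simp [hi]

end Encoding

section Lift

variable {n : ℕ}

theorem init_app (w : Fin n → Bool) (b : Bool) : Fin.init (app w b) = w :=
  Fin.init_snoc ..

theorem app_init_last (c : Fin (n + 1) → Bool) : app (Fin.init c) (c (Fin.last n)) = c :=
  Fin.snoc_init_self c

theorem last_notMem_enc (w : Fin n → Bool) : Fin.last n ∉ enc Fin.castSuccEmb w := by
  simp [mem_enc, Fin.castSucc_ne_last]

theorem enc_app_false (w : Fin n → Bool) :
    enc (Function.Embedding.refl _) (app w false) = enc Fin.castSuccEmb w := by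
  ext x
  refine Fin.lastCases ?_ (fun i => ?_) x <;> simp [mem_enc, app, Fin.castSucc_ne_last]

theorem enc_app_true (w : Fin n → Bool) :
    enc (Function.Embedding.refl _) (app w true) =
      insert (Fin.last n) (enc Fin.castSuccEmb w) := by
  ext x
  refine Fin.lastCases ?_ (fun i => ?_) x <;> simp [mem_enc, app, Fin.castSucc_ne_last]

theorem univ_erase_last :
    (univ.map (Function.Embedding.refl _)).erase (Fin.last n) = univ.map Fin.castSuccEmb := by
  ext x
  refine Fin.lastCases ?_ (fun i => ?_) x <;> simp [Fin.castSucc_ne_last]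

variable {Cstar : Finset (Fin (n + 1) → Bool)} {C C' : Finset (Fin n → Bool)}

theorem mem_iff_exists_app (hC : ∀ w, w ∈ C ↔ ∃ c ∈ Cstar, Fin.init c = w) (w : Fin n → Bool) :
    w ∈ C ↔ ∃ b, app w b ∈ Cstar := by
  rw [hC]
  constructor
  · rintro ⟨c, hc, rfl⟩
    exact ⟨_, (app_init_last c).symm ▸ hc⟩
  · rintro ⟨b, hb⟩
    exact ⟨_, hb, init_app w b⟩

theorem exists_enc_castSucc_eq {s : Finset (Fin (n + 1))} (hs : Fin.last n ∉ s) :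
    ∃ w, enc Fin.castSuccEmb w = s := by
  refine exists_enc_eq fun x hx => ?_
  rw [← univ_erase_last]
  exact mem_erase.2 ⟨fun h => hs (h ▸ hx), by simp⟩

theorem proj_image_enc (hC : ∀ w, w ∈ C ↔ ∃ c ∈ Cstar, Fin.init c = w) :
    proj (Fin.last n) (Cstar.image (enc (.refl _))) = C.image (enc Fin.castSuccEmb) := by
  have key (w : Fin n → Bool) : enc Fin.castSuccEmb w ∈ proj (Fin.last n)
      (Cstar.image (enc (.refl _))) ↔ enc Fin.castSuccEmb w ∈ C.image (enc Fin.castSuccEmb) := by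
    rw [mem_proj, ← enc_app_true, ← enc_app_false, enc_mem_image, enc_mem_image, enc_app_false,
      enc_mem_image, mem_iff_exists_app hC, Bool.exists_bool, and_iff_right (last_notMem_enc w)]
  ext s
  constructor
  · intro hs
    obtain ⟨w, rfl⟩ := exists_enc_castSucc_eq (mem_proj.1 hs).1
    exact (key w).1 hs
  · intro hs
    obtain ⟨w, -, rfl⟩ := mem_image.1 hs
    exact (key w).2 hs

theorem red_image_enc (hC' : ∀ w, w ∈ C' ↔ (app w false ∈ Cstar ∧ app w true ∈ Cstar)) :
    red (Fin.last n) (Cstar.image (enc (.refl _))) = C'.image (enc Fin.castSuccEmb) := by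
  have key (w : Fin n → Bool) : enc Fin.castSuccEmb w ∈ red (Fin.last n)
      (Cstar.image (enc (.refl _))) ↔ enc Fin.castSuccEmb w ∈ C'.image (enc Fin.castSuccEmb) := by
    rw [mem_red, ← enc_app_true, ← enc_app_false, enc_mem_image, enc_mem_image, enc_app_false,
      enc_mem_image, hC', and_iff_right (last_notMem_enc w)]
  ext s
  constructor
  · intro hs
    obtain ⟨w, rfl⟩ := exists_enc_castSucc_eq (mem_red.1 hs).1
    exact (key w).1 hs
  · intro hs
    obtain ⟨w, -, rfl⟩ := mem_image.1 hs
    exact (key w).2 hs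

/-- All vertices of a small cube of the projection extend to the maximum class by a common bit. -/
theorem IsCube.exists_app_mem {d : ℕ} (hCstar : IsMaximum Cstar d)
    (hC : ∀ w, w ∈ C ↔ ∃ c ∈ Cstar, Fin.init c = w) {Q : Finset (Fin n → Bool)}
    {I : Finset (Fin n)} (hQ : IsCube C Q I) (hI : I.card ≤ d) :
    ∃ b, ∀ c ∈ Q, app c b ∈ Cstar := by
  obtain ⟨u, hu, -⟩ := hQ.2.2 fun _ => false
  have hmax := ((isMaximum_iff (.refl _)).1 hCstar).2
  have hcube := hQ.hasCube Fin.castSuccEmb hu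
  rw [← proj_image_enc hC] at hcube
  have hlast : Fin.last n ∉ I.map Fin.castSuccEmb := by simp [Fin.castSucc_ne_last]
  have agree {c : Fin n → Bool} (hc : c ∈ Q) {i : Fin (n + 1)} (hi : i ∉ I.map Fin.castSuccEmb) :
      i ∈ enc Fin.castSuccEmb c ↔ i ∈ enc Fin.castSuccEmb u := by
    simp only [mem_enc]
    refine exists_congr fun j => and_congr_left ?_
    rintro rfl
    rw [hQ.2.1 c hc u hu j (by simpa using hi)]
  obtain h | h := hmax.hasCube_of_proj (by simp) (by simpa using hI) hcube
  · refine ⟨false, fun c hc => ?_⟩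
    rw [← enc_mem_image (e := .refl _), enc_app_false]
    exact h _ fun i hi => agree hc hi
  · refine ⟨true, fun c hc => ?_⟩
    rw [← enc_mem_image (e := .refl _), enc_app_true]
    exact h _ fun i hi => by rw [mem_insert, mem_insert, agree hc hi]

theorem isCube_pair {u v : Fin n → Bool} (hu : u ∈ C) (hv : v ∈ C) (huv : Adj u v) :
    ∃ i, IsCube C {u, v} {i} := by
  obtain ⟨i, hi⟩ := card_eq_one.1 huv
  have hne (j : Fin n) : u j ≠ v j ↔ j = i := by
    simpa using congrArg (j ∈ ·) hi
  have heq (j : Fin n) (hj : j ∉ ({i} : Finset (Fin n))) : u j = v j := by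
    simpa using (hne j).not.2 (by simpa using hj)
  refine ⟨i, by simp [insert_subset_iff, hu, hv], ?_, fun p => ?_⟩
  · grind
  · have := (hne i).2 rfl
    by_cases h : u i = p i
    · exact ⟨u, by simp, by simpa using h⟩
    · refine ⟨v, by simp, ?_⟩
      simp only [mem_singleton, forall_eq]
      revert this h
      cases u i <;> cases v i <;> cases p i <;> simp

/-- A component bit is propagated between cubes joined by a path avoiding the reduction. -/
theorem CComponentRel.app_mem {d : ℕ} (hd : 1 ≤ d) (hCstar : IsMaximum Cstar d)
    (hC : ∀ w, w ∈ C ↔ ∃ c ∈ Cstar, Fin.init c = w)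
    (hC' : ∀ w, w ∈ C' ↔ (app w false ∈ Cstar ∧ app w true ∈ Cstar))
    {Q₁ Q₂ : Finset (Fin n → Bool)} (h : CComponentRel C C' d Q₁ Q₂) {b : Bool}
    (hb : ∀ c ∈ Q₁, app c b ∈ Cstar) : ∀ c ∈ Q₂, app c b ∈ Cstar := by
  have bit_unique {w : Fin n → Bool} (hw : w ∉ C') {b₁ b₂ : Bool} (h₁ : app w b₁ ∈ Cstar)
      (h₂ : app w b₂ ∈ Cstar) : b₁ = b₂ := by
    rw [hC'] at hw
    cases b₁ <;> cases b₂ <;> simp_all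
  obtain ⟨-, ⟨I, hQ₂, hI⟩, L, p, hp₁, hp₂, hpC, hadj⟩ := h
  have hpath : ∀ j ≤ L, app (p j) b ∈ Cstar := by
    intro j
    induction j with
    | zero => exact fun _ => hb _ hp₁
    | succ j ih =>
      intro hj
      obtain ⟨i, hi⟩ := isCube_pair (hpC j (by omega)).1 (hpC (j + 1) hj).1 (hadj j (by omega))
      obtain ⟨b', hb'⟩ := hi.exists_app_mem hCstar hC (by simpa using hd)
      rw [bit_unique (hpC j (by omega)).2 (ih (by omega)) (hb' _ (by simp))]
      exact hb' _ (by simp)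
  obtain ⟨b', hb'⟩ := hQ₂.exists_app_mem hCstar hC hI.le
  rwa [bit_unique (hpC L le_rfl).2 (hpath L le_rfl) (hb' _ hp₂)]

theorem IsComponents.exists_app_mem {d k : ℕ} {Comp : Fin k → Finset (Fin n → Bool)}
    (hComp : IsComponents C C' d Comp) (hd : 1 ≤ d) (hCstar : IsMaximum Cstar d)
    (hC : ∀ w, w ∈ C ↔ ∃ c ∈ Cstar, Fin.init c = w)
    (hC' : ∀ w, w ∈ C' ↔ (app w false ∈ Cstar ∧ app w true ∈ Cstar)) (q : Fin k) :
    ∃ b, ∀ c ∈ Comp q, app c b ∈ Cstar := by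
  obtain ⟨hcover, -, -, hrel⟩ := hComp
  obtain hempty | ⟨x, hx⟩ := (Comp q).eq_empty_or_nonempty
  · exact ⟨false, by simp [hempty]⟩
  obtain ⟨Q₁, I₁, hQ₁, hI₁, -, hsub₁⟩ := hcover q x hx
  obtain ⟨b, hb⟩ := hQ₁.exists_app_mem hCstar hC hI₁.le
  refine ⟨b, fun y hy => ?_⟩
  obtain ⟨Q₂, I₂, hQ₂, hI₂, hyQ, hsub₂⟩ := hcover q y hy
  have htrans := (hrel q Q₁ I₁ hQ₁ hI₁ hsub₁ Q₂ I₂ hQ₂ hI₂).1 hsub₂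
  refine Relation.TransGen.trans_induction_on (motive := fun {R₁ R₂} _ =>
    (∀ c ∈ R₁, app c b ∈ Cstar) → ∀ c ∈ R₂, app c b ∈ Cstar) htrans
    (fun h => h.app_mem hd hCstar hC hC') (fun _ _ h₁ h₂ h => h₂ (h₁ h)) hb y hyQ

theorem IsMaximum.exists_isCube {d : ℕ} (h : IsMaximum C d) {w : Fin n → Bool} (hw : w ∈ C) :
    ∃ Q I, IsCube C Q I ∧ I.card = d ∧ w ∈ Q := by
  obtain ⟨hd, hmax⟩ := (isMaximum_iff (.refl _)).1 h
  obtain ⟨J, hJ, hcube⟩ := hmax.exists_hasCube (by simpa using hd) (enc_mem_image.2 hw)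
  exact hJ ▸ exists_isCube_of_hasCube hcube

end Lift

/-- **projection/reduction.** Let `C* ⊆ {0,1}^{n+1}` be `d`-maximum
(`1 ≤ d ≤ n`), let `C` be its projection onto the first `n` coordinates, and `C'` its
reduction in the last coordinate. Then `C` is `d`-maximum, `C'` is `(d-1)`-maximum with
`C' ⊆ C`, and for any enumeration of the `C'`-connected components of `C` there is a
choice of bits `p` with `C* = (C' × {0,1}) ∪ ⋃_q (Comp q × {p q})`. -/
theorem stmt16 (n d : ℕ) (hd : 1 ≤ d) (hdn : d ≤ n)
    (Cstar : Finset (Fin (n + 1) → Bool)) (hCstar : IsMaximum Cstar d)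
    (C : Finset (Fin n → Bool)) (hC : ∀ w, w ∈ C ↔ ∃ c ∈ Cstar, Fin.init c = w)
    (C' : Finset (Fin n → Bool))
    (hC' : ∀ w, w ∈ C' ↔ (app w false ∈ Cstar ∧ app w true ∈ Cstar)) :
    IsMaximum C d ∧ IsMaximum C' (d - 1) ∧ C' ⊆ C ∧
    ∀ (k : ℕ) (Comp : Fin k → Finset (Fin n → Bool)), IsComponents C C' d Comp →
      ∃ p : Fin k → Bool, Cstar = LiftClass C' Comp p := by
  obtain ⟨-, hmax⟩ := (isMaximum_iff (.refl _)).1 hCstar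
  have hpr := IsMaxFamily.proj_red hmax (a := Fin.last n) (by simp)
  rw [univ_erase_last, proj_image_enc hC, red_image_enc hC'] at hpr
  have hCmax : IsMaximum C d := (isMaximum_iff _).2 ⟨hdn, hpr.1⟩
  have hC'max : IsMaximum C' (d - 1) :=
    (isMaximum_iff _).2 ⟨by omega, by rw [Nat.sub_add_cancel hd]; exact hpr.2⟩
  refine ⟨hCmax, hC'max,
    fun w hw => (mem_iff_exists_app hC w).2 ⟨false, ((hC' w).1 hw).1⟩, fun k Comp hComp => ?_⟩
  choose p hp using hComp.exists_app_mem hd hCstar hC hC'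
  refine ⟨p, ?_⟩
  ext c
  obtain ⟨w, b, rfl⟩ : ∃ w b, app w b = c := ⟨_, _, app_init_last c⟩
  simp only [LiftClass, mem_union, mem_image, mem_biUnion, mem_univ, true_and]
  constructor
  · intro hc
    by_cases hw : w ∈ C'
    · cases b
      · exact .inl (.inl ⟨w, hw, rfl⟩)
      · exact .inl (.inr ⟨w, hw, rfl⟩)
    · obtain ⟨Q, I, hQ, hI, hwQ⟩ := hCmax.exists_isCube ((mem_iff_exists_app hC w).2 ⟨b, hc⟩)
      obtain ⟨q, hq⟩ := hComp.2.1 Q I hQ hI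
      refine .inr ⟨q, w, hq hwQ, ?_⟩
      have hpw := hp q w (hq hwQ)
      rw [hC'] at hw
      suffices p q = b by rw [this]
      cases b <;> cases hpq : p q <;> simp_all
  · rintro ((⟨v, hv, hvw⟩ | ⟨v, hv, hvw⟩) | ⟨q, v, hv, hvw⟩) <;> rw [← hvw]
    · exact ((hC' v).1 hv).1
    · exact ((hC' v).1 hv).2
    · exact hp q v hv

end GeomCompress
end
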